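/- Let A be an Artin algebra, D ⊆ mod A a 0-Igusa-Todorov subcategory, and I, J two ideals of A with JI = 0. Then A is a 0-LIT algebra provided that either: (1) the sets of isomorphism classes of indecomposable modules ind(A/I) \ D and ind(A/J) \ D (viewed inside mod A) are finite; or (2) ind(A/I) \ D is finite, A/J is projective as an A-module, and [Ω(mod A/J)]_D is finitely generated. -/

import Mathlib

/-!
Common framework for formalizing "On Lat-Igusa-Todorov algebras" (Barrios–Mata).

For a ring `S`, `FGMod S` is the "category" of finitely generated (left) `S`-modules;
for an Artin algebra `A`, the category `mod A` of finitely generated *right*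
`A`-modules is `FGMod Aᵐᵒᵖ`.
-/

universe u v

open Function

namespace LIT

/-- The `η` invariant from Fitting's Lemma: for an endomorphism `L` of an abelian
group `G` and a subgroup `X`, the least `k` such that for all `m ≥ k` the
restriction of `L` to `L^m(X)` is a monomorphism `L^m(X) → L^{m+1}(X)`. -/
noncomputable def eta {G : Type v} [AddCommGroup G] (L : AddMonoid.End G)
    (X : AddSubgroup G) : ℕ :=
  sInf {k : ℕ | ∀ m : ℕ, k ≤ m → Set.InjOn L (X.map (L ^ m) : Set G)}

/-- Bundled finitely generated `S`-modules. -/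
structure FGMod (S : Type u) [Ring S] : Type (u + 1) where
  carrier : Type u
  [isAddCommGroup : AddCommGroup carrier]
  [isModule : Module S carrier]
  [isFinite : Module.Finite S carrier]

attribute [instance] FGMod.isAddCommGroup FGMod.isModule FGMod.isFinite

/-- The regular module `S` over itself. -/
def FGMod.regular (S : Type u) [Ring S] : FGMod S := ⟨S⟩

/-- A ring is finitely generated as a right module over itself. -/
instance (A : Type u) [Ring A] : Module.Finite Aᵐᵒᵖ A :=
  Module.Finite.of_surjective
    ({ toFun := MulOpposite.unop
       map_add' := fun _ _ => rfl
       map_smul' := fun _ _ => rfl } : Aᵐᵒᵖ →ₗ[Aᵐᵒᵖ] A)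
    (fun x => ⟨MulOpposite.op x, rfl⟩)

namespace FGMod

variable {S : Type u} [Ring S]

/-- Projectivity of a module. -/
def IsProj (M : FGMod S) : Prop := Module.Projective S M.carrier

/-- Direct sum (product) of two modules. -/
def prodMod (M N : FGMod S) : FGMod S := ⟨M.carrier × N.carrier⟩

/-- Finite direct sums. -/
def dsum {n : ℕ} (f : Fin n → FGMod S) : FGMod S := ⟨∀ i, (f i).carrier⟩

/-- `N` is a direct summand of `M`. -/
def IsSummand (N M : FGMod S) : Prop :=
  ∃ N' : FGMod S, Nonempty (M.carrier ≃ₗ[S] N.carrier × N'.carrier)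

/-- `addOf C` is `add C`: all direct summands of finite direct sums of modules of `C`. -/
def addOf (C : Set (FGMod S)) : Set (FGMod S) :=
  {N | ∃ (n : ℕ) (f : Fin n → FGMod S), (∀ i, f i ∈ C) ∧ IsSummand N (dsum f)}

/-- `f : P → M` is a projective cover: `P` projective, `f` surjective with superfluous kernel. -/
def IsProjCover {P M : FGMod S} (f : P.carrier →ₗ[S] M.carrier) : Prop :=
  P.IsProj ∧ Surjective f ∧
    ∀ N : Submodule S P.carrier, N ⊔ LinearMap.ker f = ⊤ → N = ⊤

/-- `N` is (isomorphic to) the syzygy `Ω(M)`, i.e. the kernel of a projective cover of `M`. -/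
def IsSyzygyOf (N M : FGMod S) : Prop :=
  ∃ (P : FGMod S) (f : P.carrier →ₗ[S] M.carrier),
    IsProjCover f ∧ Nonempty (N.carrier ≃ₗ[S] LinearMap.ker f)

/-- The syzygy `Ω(M)` of `M` (a choice of it; over an Artin algebra it exists and is
unique up to isomorphism). -/
noncomputable def syz (M : FGMod S) : FGMod S :=
  letI := Classical.propDecidable (∃ N, IsSyzygyOf N M)
  if h : ∃ N, IsSyzygyOf N M then h.choose else M

/-- `SES X Y Z` : there is a short exact sequence `0 → X → Y → Z → 0`. -/
def SES (X Y Z : FGMod S) : Prop :=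
  ∃ (f : X.carrier →ₗ[S] Y.carrier) (g : Y.carrier →ₗ[S] Z.carrier),
    Injective f ∧ Surjective g ∧ LinearMap.range f = LinearMap.ker g

/-- Projective dimension, via vanishing of syzygies. -/
noncomputable def pdim (M : FGMod S) : ℕ∞ :=
  sInf ((↑) '' {n : ℕ | (syz^[n] M).IsProj})

end FGMod

open FGMod

variable {S : Type u} [Ring S]

/-- The finitistic dimension of a class of modules: the supremum of the projective
dimensions of its modules of finite projective dimension. -/
noncomputable def findim (C : Set (FGMod S)) : ℕ∞ :=
  ⨆ M ∈ {M ∈ C | pdim M ≠ ⊤}, pdim M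

/-- The global dimension of a class of modules. -/
noncomputable def gldim (C : Set (FGMod S)) : ℕ∞ :=
  ⨆ M ∈ C, pdim M

/-- The defining relations of `K₀`: `[M] - [M'] - [M'']` for `M ≅ M' ⊕ M''`, and `[P]`
for `P` projective. -/
def K0Rels (S : Type u) [Ring S] : AddSubgroup (FreeAbelianGroup (FGMod S)) :=
  AddSubgroup.closure
    ({x | ∃ M M' M'' : FGMod S,
        Nonempty (M.carrier ≃ₗ[S] M'.carrier × M''.carrier) ∧
        x = FreeAbelianGroup.of M - FreeAbelianGroup.of M' - FreeAbelianGroup.of M''} ∪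
      {x | ∃ P : FGMod S, P.IsProj ∧ x = FreeAbelianGroup.of P})

/-- `K₀(A)`: the free abelian group on the modules modulo the relations above. -/
abbrev K0 (S : Type u) [Ring S] : Type (u + 1) :=
  FreeAbelianGroup (FGMod S) ⧸ K0Rels S

/-- The class `[M]` of a module in `K₀`. -/
def toK0 (M : FGMod S) : K0 S := QuotientAddGroup.mk (FreeAbelianGroup.of M)

/-- `⟨C⟩`: the subgroup of `K₀` generated by the classes of direct summands of
modules of `C`. -/
def grpOf (C : Set (FGMod S)) : AddSubgroup (K0 S) :=
  AddSubgroup.closure {x | ∃ N M : FGMod S, M ∈ C ∧ IsSummand N M ∧ x = toK0 N}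

/-- `K_D = K₀/⟨D⟩`. -/
abbrev KD (D : Set (FGMod S)) : Type (u + 1) := K0 S ⧸ grpOf D

/-- The class of a module in `K_D`. -/
def toKD (D : Set (FGMod S)) (M : FGMod S) : KD D :=
  QuotientAddGroup.mk (toK0 M)

/-- `L` is the endomorphism `Ω̄` of `K₀` induced by the syzygy operator (it is unique). -/
def IsSyzEnd (L : AddMonoid.End (K0 S)) : Prop :=
  ∀ M : FGMod S, L (toK0 M) = toK0 (syz M)

/-- `L` is the endomorphism `Ω̄_D` of `K_D` induced by the syzygy operator. -/
def IsSyzEndD (D : Set (FGMod S)) (L : AddMonoid.End (KD D)) : Prop :=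
  ∀ M : FGMod S, L (toKD D M) = toKD D (syz M)

/-- The Igusa–Todorov function `φ`, relative to the induced endomorphism `L = Ω̄` of `K₀`. -/
noncomputable def phi (L : AddMonoid.End (K0 S)) (M : FGMod S) : ℕ :=
  eta L (grpOf {M})

/-- `φ`-dimension of a class of modules. -/
noncomputable def phidim (L : AddMonoid.End (K0 S)) (C : Set (FGMod S)) : ℕ∞ :=
  ⨆ M ∈ C, (phi L M : ℕ∞)

/-- The generalized Igusa–Todorov function `φ_[D]`, relative to `L = Ω̄_D`. -/
noncomputable def phiD (D : Set (FGMod S)) (L : AddMonoid.End (KD D)) (M : FGMod S) : ℕ :=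
  eta L ((grpOf {M}).map (QuotientAddGroup.mk' (grpOf D)))

/-- The generalized Igusa–Todorov function `ψ_[D]`. -/
noncomputable def psiD (D : Set (FGMod S)) (L : AddMonoid.End (KD D)) (M : FGMod S) : ℕ∞ :=
  (phiD D L M : ℕ∞) + findim (addOf {syz^[phiD D L M] M})

/-- `D` is a `0`-Igusa–Todorov subcategory: `D = add D`, `Ω(D) ⊆ D` and `φdim D = 0`. -/
def IsZeroIT (L : AddMonoid.End (K0 S)) (D : Set (FGMod S)) : Prop :=
  D = addOf D ∧ (∀ M ∈ D, syz M ∈ D) ∧ phidim L D = 0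

/-- The class `C` is `(n,V,D)`-Lat-Igusa-Todorov: every `M ∈ C` admits an exact sequence
`0 → V₁ ⊕ D₁ → V₀ ⊕ D₀ → Ωⁿ(M) → 0` with `V₁, V₀ ∈ add V` and `D₁, D₀ ∈ D`. -/
def IsLITClass (n : ℕ) (V : FGMod S) (D : Set (FGMod S)) (C : Set (FGMod S)) : Prop :=
  ∀ M ∈ C, ∃ V1 V0 D1 D0 : FGMod S,
    V1 ∈ addOf {V} ∧ V0 ∈ addOf {V} ∧ D1 ∈ D ∧ D0 ∈ D ∧
    SES (prodMod V1 D1) (prodMod V0 D0) (syz^[n] M)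

/-- `[C]_D`: the image of `⟨C⟩` in `K_D`, i.e. `(⟨C⟩ + ⟨D⟩)/⟨D⟩`. -/
def classGrpD (D C : Set (FGMod S)) : AddSubgroup (KD D) :=
  (grpOf C).map (QuotientAddGroup.mk' (grpOf D))

/-- `C` is `D`-syzygy finite: `[Ω^k(C)]_D` is finitely generated for some `k`. -/
def DSyzFinite (D C : Set (FGMod S)) : Prop :=
  ∃ k : ℕ, (classGrpD D ((fun M => syz^[k] M) '' C)).FG

/-- The algebra is `n`-LIT: there are a `0`-Igusa–Todorov subcategory `D` and a module `V`
such that `mod A` is `(n,V,D)`-LIT. -/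
def IsNLITAlgebra (L : AddMonoid.End (K0 S)) (n : ℕ) : Prop :=
  ∃ (V : FGMod S) (D : Set (FGMod S)), IsZeroIT L D ∧ IsLITClass n V D Set.univ

/-- The algebra is LIT: it is `n`-LIT for some `n`. -/
def IsLITAlgebra (L : AddMonoid.End (K0 S)) : Prop :=
  ∃ n : ℕ, IsNLITAlgebra L n


/-! Indecomposable modules, finiteness up to isomorphism, and modules over quotient
algebras viewed inside `mod A`. -/

/-- `M` is indecomposable: nonzero, and any direct sum decomposition is trivial. -/
def Indec {S : Type u} [Ring S] (M : FGMod S) : Prop :=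
  ¬ Subsingleton M.carrier ∧
    ∀ N N' : FGMod S, Nonempty (M.carrier ≃ₗ[S] N.carrier × N'.carrier) →
      Subsingleton N.carrier ∨ Subsingleton N'.carrier

/-- A class of modules contains only finitely many isomorphism classes. -/
def FinUpToIso {S : Type u} [Ring S] (C : Set (FGMod S)) : Prop :=
  ∃ (n : ℕ) (f : Fin n → FGMod S),
    ∀ M ∈ C, ∃ i, Nonempty (M.carrier ≃ₗ[S] (f i).carrier)

/-- The right `A`-modules annihilated by a (two-sided) ideal `I`, i.e. the image of
`mod (A/I)` inside `mod A`. -/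
def annClass {A : Type u} [Ring A] (I : Submodule Aᵐᵒᵖ A) : Set (FGMod Aᵐᵒᵖ) :=
  {M | ∀ (m : M.carrier), ∀ a ∈ I, MulOpposite.op a • m = 0}

/-- The right `A`-module `A/I`. -/
def qmod {A : Type u} [Ring A] (I : Submodule Aᵐᵒᵖ A) : FGMod Aᵐᵒᵖ := ⟨A ⧸ I⟩

section Closure

variable {S : Type u} [Ring S]

theorem FGMod.IsSummand.of_equiv {M N : FGMod S} (e : M.carrier ≃ₗ[S] N.carrier) :
    IsSummand N M :=
  ⟨⟨PUnit⟩, ⟨e.trans LinearEquiv.prodUnique.symm⟩⟩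

theorem FGMod.IsSummand.refl (M : FGMod S) : IsSummand M M :=
  .of_equiv (.refl S _)

theorem FGMod.IsSummand.trans {K N M : FGMod S} (h : IsSummand K N) (h' : IsSummand N M) :
    IsSummand K M := by
  obtain ⟨N', ⟨e⟩⟩ := h
  obtain ⟨M', ⟨e'⟩⟩ := h'
  exact ⟨prodMod N' M', ⟨e'.trans
    ((e.prodCongr (LinearEquiv.refl S _)).trans (LinearEquiv.prodAssoc S _ _ _))⟩⟩

theorem FGMod.IsSummand.prod {K N K' N' : FGMod S} (h : IsSummand K N) (h' : IsSummand K' N') :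
    IsSummand (prodMod K K') (prodMod N N') := by
  obtain ⟨M, ⟨e⟩⟩ := h
  obtain ⟨M', ⟨e'⟩⟩ := h'
  exact ⟨prodMod M M', ⟨(e.prodCongr e').trans (LinearEquiv.prodProdProdComm S _ _ _ _)⟩⟩

theorem FGMod.isSummand_prodMod_left (M N : FGMod S) : IsSummand M (prodMod M N) :=
  ⟨N, ⟨.refl S _⟩⟩

theorem FGMod.isSummand_prodMod_right (M N : FGMod S) : IsSummand N (prodMod M N) :=
  ⟨M, ⟨LinearEquiv.prodComm S _ _⟩⟩

/-- A split monomorphism exhibits its source as a direct summand. -/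
theorem FGMod.IsSummand.of_leftInverse [IsNoetherianRing S] {M N : FGMod S}
    (f : N.carrier →ₗ[S] M.carrier) (g : M.carrier →ₗ[S] N.carrier)
    (h : ∀ x, g (f x) = x) : IsSummand N M :=
  ⟨⟨LinearMap.ker g⟩,
    ⟨{ toFun := fun m => (g m, ⟨m - f (g m), by simp [h]⟩)
       map_add' := fun x y => by
        ext
        · simp
        · simp; abel
       map_smul' := fun r x => by
        ext
        · simp
        · simp [smul_sub]
       invFun := fun p => f p.1 + p.2
       left_inv := fun m => by simp
       right_inv := fun p => by
        have hp := LinearMap.mem_ker.mp p.2.2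
        ext
        · simp [h, hp]
        · simp [h, hp] }⟩⟩

theorem FGMod.isSummand_dsum [IsNoetherianRing S] {n : ℕ} (f : Fin n → FGMod S) (i : Fin n) :
    IsSummand (f i) (dsum f) :=
  .of_leftInverse (N := f i) (M := dsum f) (LinearMap.single S (fun i => (f i).carrier) i)
    (LinearMap.proj (R := S) (φ := fun i => (f i).carrier) i)
    fun x => Pi.single_eq_same (M := fun i => (f i).carrier) i x

theorem FGMod.addOf_of_isSummand {C : Set (FGMod S)} {M N : FGMod S} (hM : M ∈ addOf C)
    (h : IsSummand N M) : N ∈ addOf C := by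
  obtain ⟨n, f, hf, hs⟩ := hM
  exact ⟨n, f, hf, h.trans hs⟩

theorem FGMod.mem_addOf {C : Set (FGMod S)} {M : FGMod S} (hM : M ∈ C) : M ∈ addOf C :=
  ⟨1, fun _ => M, fun _ => hM,
    .of_equiv (M := dsum fun _ : Fin 1 => M) (LinearEquiv.funUnique (Fin 1) S M.carrier)⟩

theorem FGMod.addOf_of_subsingleton (C : Set (FGMod S)) {M : FGMod S}
    (hM : Subsingleton M.carrier) : M ∈ addOf C :=
  ⟨0, Fin.elim0, fun i => i.elim0,
    .of_equiv (M := dsum Fin.elim0)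
      { toFun := fun _ => 0
        map_add' := fun _ _ => by simp
        map_smul' := fun _ _ => by simp
        invFun := fun _ i => i.elim0
        left_inv := fun _ => funext fun i => i.elim0
        right_inv := fun _ => Subsingleton.elim _ _ }⟩

theorem FGMod.addOf_prodMod {C : Set (FGMod S)} {M N : FGMod S} (hM : M ∈ addOf C)
    (hN : N ∈ addOf C) : prodMod M N ∈ addOf C := by
  obtain ⟨m, f, hf, hs⟩ := hM
  obtain ⟨n, g, hg, ht⟩ := hN
  refine ⟨m + n, fun i => Sum.elim f g (finSumFinEquiv.symm i), fun i => ?_,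
    (hs.prod ht).trans (.of_equiv ?_)⟩
  · beta_reduce
    rcases finSumFinEquiv.symm i with j | j
    exacts [hf j, hg j]
  · exact (LinearEquiv.piCongrLeft' S (fun s => (Sum.elim f g s).carrier) finSumFinEquiv).symm.trans
      (LinearEquiv.sumPiEquivProdPi S (Fin m) (Fin n) fun s => (Sum.elim f g s).carrier)

theorem FGMod.addOf_singleton_mono {V W M : FGMod S} (hM : M ∈ addOf {V}) (h : IsSummand V W) :
    M ∈ addOf {W} := by
  obtain ⟨n, f, hf, hs⟩ := hM
  obtain ⟨V', ⟨e⟩⟩ := h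
  obtain rfl : f = fun _ => V := funext hf
  refine ⟨n, fun _ => W, fun _ => rfl, hs.trans ⟨dsum fun _ : Fin n => V', ⟨?_⟩⟩⟩
  exact (LinearEquiv.piCongrRight fun _ => e).trans
    { toFun := fun x => (fun i => (x i).1, fun i => (x i).2)
      map_add' := fun _ _ => rfl
      map_smul' := fun _ _ => rfl
      invFun := fun p i => (p.1 i, p.2 i)
      left_inv := fun _ => rfl
      right_inv := fun _ => rfl }

theorem FGMod.addOf_singleton_of_isSummand {V M : FGMod S} (h : IsSummand M V) :
    M ∈ addOf {V} :=
  addOf_of_isSummand (mem_addOf rfl) h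

theorem FGMod.IsProj.mem_addOf_regular {P : FGMod S} [IsNoetherianRing S] (hP : P.IsProj) :
    P ∈ addOf {FGMod.regular S} := by
  have : Module.Projective S P.carrier := hP
  obtain ⟨n, f, hf⟩ := Module.Finite.exists_fin' S P.carrier
  obtain ⟨g, hg⟩ := Module.projective_lifting_property f LinearMap.id hf
  exact ⟨n, fun _ => FGMod.regular S, fun _ => rfl,
    .of_leftInverse (N := P) (M := dsum fun _ : Fin n => FGMod.regular S) g f
      fun x => LinearMap.congr_fun hg x⟩

theorem FGMod.IsProj.of_isSummand {P Q : FGMod S} (hP : P.IsProj) (h : IsSummand Q P) :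
    Q.IsProj := by
  have : Module.Projective S P.carrier := hP
  obtain ⟨Q', ⟨e⟩⟩ := h
  exact Module.Projective.of_split (e.symm.toLinearMap ∘ₗ LinearMap.inl S _ _)
    (LinearMap.fst S _ _ ∘ₗ e.toLinearMap) (by ext; simp)

theorem FGMod.IsProj.prodMod {P Q : FGMod S} (hP : P.IsProj) (hQ : Q.IsProj) :
    (prodMod P Q).IsProj := by
  have : Module.Projective S P.carrier := hP
  have : Module.Projective S Q.carrier := hQ
  exact inferInstanceAs (Module.Projective S (P.carrier × Q.carrier))

theorem FGMod.SES.of_equiv {X Y Z X' Y' Z' : FGMod S} (h : SES X Y Z)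
    (eX : X.carrier ≃ₗ[S] X'.carrier) (eY : Y.carrier ≃ₗ[S] Y'.carrier)
    (eZ : Z.carrier ≃ₗ[S] Z'.carrier) : SES X' Y' Z' := by
  obtain ⟨f, g, hf, hg, hfg⟩ := h
  refine ⟨eY.toLinearMap ∘ₗ f ∘ₗ eX.symm.toLinearMap, eZ.toLinearMap ∘ₗ g ∘ₗ eY.symm.toLinearMap,
    ?_, ?_, ?_⟩
  · exact eY.injective.comp (hf.comp eX.symm.injective)
  · exact eZ.surjective.comp (hg.comp eY.symm.surjective)
  · ext y
    have := SetLike.ext_iff.mp hfg (eY.symm y)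
    simp only [LinearMap.mem_range, LinearMap.mem_ker] at this
    simp only [LinearMap.mem_range, LinearMap.coe_comp, LinearEquiv.coe_coe, Function.comp_apply,
      LinearMap.mem_ker, LinearEquiv.map_eq_zero_iff, ← this]
    constructor
    · rintro ⟨x, rfl⟩
      exact ⟨eX.symm x, by simp⟩
    · rintro ⟨x, hx⟩
      exact ⟨eX x, by simp [hx]⟩

theorem FGMod.SES.prod {X Y Z X' Y' Z' : FGMod S} (h : SES X Y Z) (h' : SES X' Y' Z') :
    SES (prodMod X X') (prodMod Y Y') (prodMod Z Z') := by
  obtain ⟨f, g, hf, hg, hfg⟩ := h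
  obtain ⟨f', g', hf', hg', hfg'⟩ := h'
  refine ⟨f.prodMap f', g.prodMap g', hf.prodMap hf', hg.prodMap hg', ?_⟩
  exact (LinearMap.range_prodMap f f').trans
    ((show _ = _ by rw [hfg, hfg']).trans (LinearMap.ker_prodMap g g').symm)

end Closure

section Artinian

variable {S : Type u} [Ring S] [IsArtinianRing S]

/-- Over an artinian ring every finitely generated module has a projective cover. -/
theorem FGMod.isSyzygyOf_syz (M : FGMod S) : IsSyzygyOf (syz M) M := by
  suffices h : ∃ N, IsSyzygyOf N M by
    unfold syz
    rw [dif_pos h]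
    exact h.choose_spec
  let p (k : ℕ) : Prop := ∃ (P : FGMod S) (f : P.carrier →ₗ[S] M.carrier),
    P.IsProj ∧ Surjective f ∧ Module.length S P.carrier = k
  have hp : ∃ k, p k := by
    obtain ⟨n, f, hf⟩ := Module.Finite.exists_fin' S M.carrier
    obtain ⟨k, hk⟩ := ENat.ne_top_iff_exists.mp (Module.length_ne_top (R := S) (M := Fin n → S))
    exact ⟨k, ⟨Fin n → S⟩, f, inferInstanceAs (Module.Projective S (Fin n → S)), hf, hk.symm⟩
  classical
  obtain ⟨P, f, hP, hf, hl⟩ := Nat.find_spec hp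
  refine ⟨⟨LinearMap.ker f⟩, P, f, ⟨hP, hf, fun N hN => ?_⟩, ⟨.refl S _⟩⟩
  have : Module.Projective S P.carrier := hP
  have hfN : Surjective (f ∘ₗ N.subtype) := fun m => by
    obtain ⟨x, rfl⟩ := hf m
    obtain ⟨y, hy, z, hz, rfl⟩ := Submodule.mem_sup.mp (hN ▸ Submodule.mem_top (x := x))
    exact ⟨⟨y, hy⟩, by simp [LinearMap.mem_ker.mp hz]⟩
  obtain ⟨g, hg⟩ := Module.projective_lifting_property (f ∘ₗ N.subtype) f hfN
  let e : Module.End S P.carrier := N.subtype ∘ₗ g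
  have he : ∀ x, f (e x) = f x := fun x => LinearMap.congr_fun hg x
  have hen : ∀ (n : ℕ) x, f ((e ^ n) x) = f x := fun n => by
    induction n with
    | zero => simp
    | succ n ih => intro x; rw [pow_succ', Module.End.mul_apply, he, ih]
  obtain ⟨n, hn, hn1⟩ := (e.eventually_isCompl_ker_pow_range_pow.and
    (Filter.eventually_ge_atTop 1)).exists
  have hle : LinearMap.range (e ^ n) ≤ N := by
    rintro _ ⟨x, rfl⟩
    obtain ⟨k, rfl⟩ := Nat.exists_eq_add_of_le' hn1
    rw [pow_succ', Module.End.mul_apply]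
    exact (g _).2
  have hsum : IsSummand ⟨LinearMap.range (e ^ n)⟩ P :=
    ⟨⟨LinearMap.ker (e ^ n)⟩, ⟨(Submodule.prodEquivOfIsCompl _ _ hn.symm).symm⟩⟩
  by_contra hne
  have hlt : Module.length S (LinearMap.range (e ^ n)) < Module.length S P.carrier :=
    Submodule.length_lt fun h => hne (top_le_iff.mp (h ▸ hle))
  obtain ⟨k, hk⟩ := ENat.ne_top_iff_exists.mp hlt.ne_top
  rw [hl, ← hk, Nat.cast_lt] at hlt
  refine Nat.find_min hp hlt ⟨⟨LinearMap.range (e ^ n)⟩, f ∘ₗ Submodule.subtype _,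
    hP.of_isSummand hsum, fun m => ?_, hk.symm⟩
  obtain ⟨x, rfl⟩ := hf m
  exact ⟨⟨_, x, rfl⟩, hen n x⟩

theorem FGMod.exists_SES_syz (M : FGMod S) : ∃ P : FGMod S, P.IsProj ∧ SES (syz M) P M := by
  obtain ⟨P, f, ⟨hP, hf, -⟩, ⟨e⟩⟩ := isSyzygyOf_syz M
  refine ⟨P, hP, (LinearMap.ker f).subtype ∘ₗ e.toLinearMap, f,
    (Submodule.subtype_injective _).comp e.injective, hf, ?_⟩
  rw [LinearMap.range_comp_of_range_eq_top _ e.range, Submodule.range_subtype]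

/-- An induction principle: to prove a property of modules in a class closed under direct
summands it is enough to consider indecomposable modules. -/
theorem FGMod.indec_induction {p q : FGMod S → Prop}
    (hp : ∀ M N, IsSummand N M → p M → p N) (hzero : ∀ M, Subsingleton M.carrier → q M)
    (hindec : ∀ M, p M → Indec M → q M)
    (hprod : ∀ M N N' : FGMod S, (M.carrier ≃ₗ[S] N.carrier × N'.carrier) → q N → q N' → q M)
    (M : FGMod S) (hM : p M) : q M := by
  have hfin (M : FGMod S) : ∃ k : ℕ, k = Module.length S M.carrier :=
    ENat.ne_top_iff_exists.mp Module.length_ne_top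
  obtain ⟨k, hk⟩ := hfin M
  induction k using Nat.strong_induction_on generalizing M with
  | _ k ih =>
    by_cases h0 : Subsingleton M.carrier
    · exact hzero M h0
    by_cases hi : Indec M
    · exact hindec M hM hi
    obtain ⟨N, N', ⟨e⟩, hN, hN'⟩ : ∃ N N' : FGMod S,
        Nonempty (M.carrier ≃ₗ[S] N.carrier × N'.carrier) ∧
          ¬ Subsingleton N.carrier ∧ ¬ Subsingleton N'.carrier := by
      by_contra! hne
      exact hi ⟨h0, fun N N' e => or_iff_not_imp_left.mpr
        fun hN => hne N N' e (not_subsingleton_iff_nontrivial.mp hN)⟩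
    obtain ⟨a, ha⟩ := hfin N
    obtain ⟨b, hb⟩ := hfin N'
    have hab : k = a + b := by
      have := e.length_eq
      rw [Module.length_prod, ← hk, ← ha, ← hb] at this
      exact_mod_cast this
    rw [← Module.length_eq_zero_iff (R := S), ← ha, Nat.cast_eq_zero] at hN
    rw [← Module.length_eq_zero_iff (R := S), ← hb, Nat.cast_eq_zero] at hN'
    exact hprod M N N' e (ih a (by omega) N (hp M N ⟨N', ⟨e⟩⟩ hM) ha)
      (ih b (by omega) N' (hp M N' ⟨N, ⟨e.trans (LinearEquiv.prodComm S _ _)⟩⟩ hM) hb)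

/-- Fitting's lemma. -/
theorem Indec.isUnit_or_isNilpotent {X : FGMod S} (hX : Indec X)
    (f : Module.End S X.carrier) : IsUnit f ∨ IsNilpotent f := by
  obtain ⟨n, hn, hn1⟩ := (f.eventually_isCompl_ker_pow_range_pow.and
    (Filter.eventually_ge_atTop 1)).exists
  rcases hX.2 ⟨LinearMap.ker (f ^ n)⟩ ⟨LinearMap.range (f ^ n)⟩
    ⟨(Submodule.prodEquivOfIsCompl _ _ hn).symm⟩ with h | h
  · have hker : LinearMap.ker (f ^ n) = ⊥ := Submodule.subsingleton_iff_eq_bot.mp h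
    have hrange : LinearMap.range (f ^ n) = ⊤ := by simpa [hker] using hn.sup_eq_top
    left
    rw [← isUnit_pow_iff (Nat.one_le_iff_ne_zero.mp hn1), Module.End.isUnit_iff]
    exact ⟨LinearMap.ker_eq_bot.mp hker, LinearMap.range_eq_top.mp hrange⟩
  · exact .inr ⟨n, LinearMap.range_eq_bot.mp (Submodule.subsingleton_iff_eq_bot.mp h)⟩

/-- The endomorphism ring of an indecomposable module is local. -/
theorem Indec.isUnit_or_isUnit_of_isUnit_add {X : FGMod S} (hX : Indec X)
    {f g : Module.End S X.carrier} (h : IsUnit (f + g)) : IsUnit f ∨ IsUnit g := by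
  obtain ⟨u, hu⟩ := h
  have hsum : ↑u⁻¹ * g = 1 - ↑u⁻¹ * f := by
    rw [eq_sub_iff_add_eq', ← mul_add, ← hu, Units.inv_mul]
  rcases hX.isUnit_or_isNilpotent (↑u⁻¹ * f) with h | h
  · exact .inl ((Units.isUnit_units_mul _ _).mp h)
  · exact .inr ((Units.isUnit_units_mul _ _).mp (hsum ▸ h.isUnit_one_sub))

end Artinian

section Multiplicity

variable (R : Type u) [CommRing R] {S : Type u} [Ring S] [Algebra R S]

/-- A module over an `R`-algebra, regarded as an `R`-module. -/
@[reducible]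
def FGMod.restrictScalars (M : FGMod S) : Module R M.carrier :=
  Module.compHom M.carrier (algebraMap R S)

attribute [local instance] FGMod.restrictScalars

local instance (M : FGMod S) : IsScalarTower R S M.carrier :=
  ⟨fun r s m => by
    rw [Algebra.smul_def, mul_smul]
    rfl⟩

local instance (M : FGMod S) : SMulCommClass S R M.carrier :=
  ⟨fun s r m => by
    rw [← algebraMap_smul S r m, ← algebraMap_smul S r (s • m), ← mul_smul, ← mul_smul,
      Algebra.commutes]⟩

theorem FGMod.finite_linearMap [IsNoetherianRing R] [Module.Finite R S] (M N : FGMod S) :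
    Module.Finite R (M.carrier →ₗ[S] N.carrier) := by
  have : Module.Finite R N.carrier := Module.Finite.trans S N.carrier
  obtain ⟨n, f, hf⟩ := Module.Finite.exists_fin' S M.carrier
  let F : (M.carrier →ₗ[S] N.carrier) →ₗ[R] (Fin n → N.carrier) :=
    { toFun := fun g i => g (f (Pi.single i 1))
      map_add' := fun _ _ => rfl
      map_smul' := fun _ _ => rfl }
  refine Module.Finite.of_injective F fun g h hgh => ?_
  have : g ∘ₗ f = h ∘ₗ f := by
    ext i
    exact congrFun hgh i
  ext m
  obtain ⟨x, rfl⟩ := hf m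
  exact LinearMap.congr_fun this x

variable [IsArtinianRing S]

/-- The radical of `Hom(X, M)` for an indecomposable module `X`: the maps which are not
split monomorphisms. -/
def radHom {X : FGMod S} (hX : Indec X) (M : FGMod S) :
    Submodule R (X.carrier →ₗ[S] M.carrier) where
  carrier := {f | ∀ g : M.carrier →ₗ[S] X.carrier, ¬ IsUnit (M := Module.End S X.carrier) (g ∘ₗ f)}
  add_mem' := fun {a b} ha hb g h => by
    rw [LinearMap.comp_add] at h
    exact (hX.isUnit_or_isUnit_of_isUnit_add h).elim (ha g) (hb g)
  zero_mem' := fun g h => by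
    rw [LinearMap.comp_zero] at h
    have : Nontrivial (Module.End S X.carrier) := by
      have := not_subsingleton_iff_nontrivial.mp hX.1
      infer_instance
    exact not_isUnit_zero h
  smul_mem' := fun r f hf g h => by
    refine hf (r • g) ?_
    rwa [LinearMap.comp_smul] at h

/-- The multiplicity of an indecomposable module `X` as a direct summand of `M`, scaled by the
length of the residue division ring of `End X`. -/
noncomputable def mult {X : FGMod S} (hX : Indec X) (M : FGMod S) : ℕ :=
  (Module.length R ((X.carrier →ₗ[S] M.carrier) ⧸ radHom R hX M)).toNat

theorem mem_radHom_comp {X M N : FGMod S} (hX : Indec X) (h : M.carrier →ₗ[S] N.carrier)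
    {f : X.carrier →ₗ[S] M.carrier} (hf : f ∈ radHom R hX M) : h ∘ₗ f ∈ radHom R hX N :=
  fun g => hf (g ∘ₗ h)

variable [IsArtinianRing R] [Module.Finite R S]

theorem length_quotient_radHom_ne_top {X : FGMod S} (hX : Indec X) (M : FGMod S) :
    Module.length R ((X.carrier →ₗ[S] M.carrier) ⧸ radHom R hX M) ≠ ⊤ := by
  have := FGMod.finite_linearMap R X M
  exact Module.length_ne_top

theorem mult_eq_zero_iff {X : FGMod S} (hX : Indec X) (M : FGMod S) :
    mult R hX M = 0 ↔ ¬ IsSummand X M := by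
  rw [mult, ENat.toNat_eq_zero, or_iff_left (length_quotient_radHom_ne_top R hX M),
    Module.length_eq_zero_iff, Submodule.Quotient.subsingleton_iff, ← not_iff_not, not_not]
  constructor
  · intro h
    obtain ⟨f, hf⟩ : ∃ f, f ∉ radHom R hX M := by
      by_contra! hne
      exact h (eq_top_iff.mpr fun f _ => hne f)
    obtain ⟨g, u, hu⟩ : ∃ g : M.carrier →ₗ[S] X.carrier,
        IsUnit (M := Module.End S X.carrier) (g ∘ₗ f) := by
      by_contra! hne
      exact hf hne
    refine .of_leftInverse f (((u⁻¹ : (Module.End S X.carrier)ˣ) : Module.End S X.carrier) ∘ₗ g)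
      fun x => ?_
    have := LinearMap.congr_fun u.inv_mul x
    rwa [hu] at this
  · rintro ⟨N, ⟨e⟩⟩ h
    have : e.symm.toLinearMap ∘ₗ LinearMap.inl S _ _ ∈ radHom R hX M := h ▸ Submodule.mem_top
    refine this (LinearMap.fst S _ _ ∘ₗ e.toLinearMap) ?_
    convert isUnit_one (M := Module.End S X.carrier)
    ext x
    simp

theorem mult_prod {X : FGMod S} (hX : Indec X) {M N N' : FGMod S}
    (e : M.carrier ≃ₗ[S] N.carrier × N'.carrier) :
    mult R hX M = mult R hX N + mult R hX N' := by
  let p : M.carrier →ₗ[S] N.carrier := LinearMap.fst S _ _ ∘ₗ e.toLinearMap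
  let p' : M.carrier →ₗ[S] N'.carrier := LinearMap.snd S _ _ ∘ₗ e.toLinearMap
  let i : N.carrier →ₗ[S] M.carrier := e.symm.toLinearMap ∘ₗ LinearMap.inl S _ _
  let i' : N'.carrier →ₗ[S] M.carrier := e.symm.toLinearMap ∘ₗ LinearMap.inr S _ _
  have hi (x : M.carrier) : i (p x) + i' (p' x) = x := by
    simp [i, i', p, p', ← map_add]
  let F : (X.carrier →ₗ[S] M.carrier) →ₗ[R]
      ((X.carrier →ₗ[S] N.carrier) ⧸ radHom R hX N) ×
        ((X.carrier →ₗ[S] N'.carrier) ⧸ radHom R hX N') :=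
    { toFun := fun f => (Submodule.Quotient.mk (p ∘ₗ f), Submodule.Quotient.mk (p' ∘ₗ f))
      map_add' := fun f g => by
        simp only [LinearMap.comp_add, Submodule.Quotient.mk_add, Prod.mk_add_mk]
      map_smul' := fun r f => by
        have h (Y : FGMod S) (q : M.carrier →ₗ[S] Y.carrier) : q ∘ₗ (r • f) = r • (q ∘ₗ f) := by
          ext x
          exact q.map_smul_of_tower r (f x)
        simp only [h, Submodule.Quotient.mk_smul, Prod.smul_mk, RingHom.id_apply] }
  have hF : Surjective F := by
    rintro ⟨a, b⟩
    obtain ⟨a, rfl⟩ := Submodule.Quotient.mk_surjective _ a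
    obtain ⟨b, rfl⟩ := Submodule.Quotient.mk_surjective _ b
    refine ⟨i ∘ₗ a + i' ∘ₗ b, Prod.ext ?_ ?_⟩
    · refine congrArg Submodule.Quotient.mk ?_
      ext x
      simp [i, i', p]
    · refine congrArg Submodule.Quotient.mk ?_
      ext x
      simp [i, i', p']
  have hker : LinearMap.ker F = radHom R hX M := by
    ext f
    simp only [LinearMap.mem_ker, F, LinearMap.coe_mk, AddHom.coe_mk, Prod.mk_eq_zero,
      Submodule.Quotient.mk_eq_zero]
    refine ⟨fun ⟨h, h'⟩ => ?_, fun h => ⟨mem_radHom_comp R hX p h, mem_radHom_comp R hX p' h⟩⟩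
    have := (radHom R hX M).add_mem (mem_radHom_comp R hX i h) (mem_radHom_comp R hX i' h')
    convert this using 1
    ext x
    exact (hi (f x)).symm
  have hl := (F.quotKerEquivOfSurjective hF).length_eq
  rw [hker, Module.length_prod] at hl
  rw [mult, mult, mult, hl, ENat.toNat_add (length_quotient_radHom_ne_top R hX N)
    (length_quotient_radHom_ne_top R hX N')]

end Multiplicity

/-- The multiplicity of a non-projective indecomposable module outside `D` factors
through `K_D`. -/
theorem exists_KD_hom_eq_mult (R : Type u) [CommRing R] [IsArtinianRing R] {S : Type u} [Ring S]
    [Algebra R S] [Module.Finite R S] [IsArtinianRing S] {D : Set (FGMod S)}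
    (hD : D = addOf D) {X : FGMod S} (hX : Indec X) (hproj : ¬ X.IsProj) (hXD : X ∉ D) :
    ∃ m : KD D →+ ℤ, ∀ M, m (toKD D M) = mult R hX M := by
  let m₀ : FreeAbelianGroup (FGMod S) →+ ℤ := FreeAbelianGroup.lift fun M => (mult R hX M : ℤ)
  have h₀ : K0Rels S ≤ m₀.ker := by
    rw [K0Rels, AddSubgroup.closure_le]
    rintro x (⟨M, M', M'', ⟨e⟩, rfl⟩ | ⟨P, hP, rfl⟩)
    · simp [AddMonoidHom.mem_ker, m₀, mult_prod R hX e]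
    · simpa [AddMonoidHom.mem_ker, m₀, mult_eq_zero_iff] using fun h => hproj (hP.of_isSummand h)
  let m₁ : K0 S →+ ℤ := QuotientAddGroup.lift (K0Rels S) m₀ h₀
  have hm₁ (M : FGMod S) : m₁ (toK0 M) = mult R hX M :=
    (QuotientAddGroup.lift_mk' _ _ _).trans (FreeAbelianGroup.lift_apply_of _ _)
  have h₁ : grpOf D ≤ m₁.ker := by
    rw [grpOf, AddSubgroup.closure_le]
    rintro _ ⟨N, M, hM, hNM, rfl⟩
    rw [SetLike.mem_coe, AddMonoidHom.mem_ker, hm₁, Nat.cast_eq_zero, mult_eq_zero_iff]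
    intro h
    rw [hD] at hXD hM
    exact hXD (addOf_of_isSummand hM (h.trans hNM))
  exact ⟨QuotientAddGroup.lift (grpOf D) m₁ h₁, fun M =>
    (QuotientAddGroup.lift_mk' _ _ _).trans (hm₁ M)⟩

/-- If `[C]_D` is finitely generated, there is a module `N` having as direct summands all
non-projective indecomposable modules outside `D` which are direct summands of modules in `C`. -/
theorem exists_isSummand_of_classGrpD_fg (R : Type u) [CommRing R] [IsArtinianRing R] {S : Type u} [Ring S]
    [Algebra R S] [Module.Finite R S] [IsArtinianRing S] {D C : Set (FGMod S)}
    (hD : D = addOf D) (hC : (classGrpD D C).FG) :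
    ∃ N : FGMod S, ∀ X M : FGMod S, Indec X → ¬ X.IsProj → X ∉ D → M ∈ C → IsSummand X M →
      IsSummand X N := by
  let vanish (N : FGMod S) (x : KD D) : Prop := ∀ (X : FGMod S) (hX : Indec X),
    ¬ IsSummand X N → ∀ m : KD D →+ ℤ, (∀ M, m (toKD D M) = mult R hX M) → m x = 0
  have vanish_mono {N N' : FGMod S} (h : IsSummand N N') {x : KD D} (hx : vanish N x) :
      vanish N' x := fun X hX hXN => hx X hX fun h' => hXN (h'.trans h)
  have hmem (x : KD D) (hx : x ∈ classGrpD D C) : ∃ N, vanish N x := by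
    obtain ⟨y, hy, rfl⟩ := hx
    induction hy using AddSubgroup.closure_induction with
    | mem y hy =>
      obtain ⟨N, -, -, -, rfl⟩ := hy
      refine ⟨N, fun X hX hXN m hm => (hm N).trans ?_⟩
      exact_mod_cast (mult_eq_zero_iff R hX N).mpr hXN
    | zero => exact ⟨⟨PUnit⟩, fun X hX _ m _ => by simp⟩
    | add y z _ _ hy hz =>
      obtain ⟨N, hN⟩ := hy
      obtain ⟨N', hN'⟩ := hz
      refine ⟨prodMod N N', fun X hX hXN m hm => ?_⟩
      rw [map_add, map_add, vanish_mono (isSummand_prodMod_left N N') hN X hX hXN m hm,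
        vanish_mono (isSummand_prodMod_right N N') hN' X hX hXN m hm, add_zero]
    | neg y _ hy =>
      obtain ⟨N, hN⟩ := hy
      exact ⟨N, fun X hX hXN m hm => by rw [map_neg, map_neg, hN X hX hXN m hm, neg_zero]⟩
  have hfin (t : Finset (KD D)) : (∀ x ∈ t, x ∈ classGrpD D C) → ∃ N, ∀ x ∈ t, vanish N x := by
    classical
    induction t using Finset.induction_on with
    | empty => exact fun _ => ⟨⟨PUnit⟩, by simp⟩
    | insert a t _ ih =>
      intro h
      rw [Finset.forall_mem_insert] at h
      obtain ⟨N, hN⟩ := hmem a h.1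
      obtain ⟨N', hN'⟩ := ih h.2
      refine ⟨prodMod N N', (Finset.forall_mem_insert _ _ _).mpr
        ⟨vanish_mono (isSummand_prodMod_left N N') hN,
          fun x hx => vanish_mono (isSummand_prodMod_right N N') (hN' x hx)⟩⟩
  obtain ⟨t, ht⟩ := hC
  obtain ⟨N, hN⟩ := hfin t fun x hx => ht ▸ AddSubgroup.subset_closure hx
  refine ⟨N, fun X M hX hproj hXD hM hXM => ?_⟩
  by_contra hXN
  obtain ⟨m, hm⟩ := exists_KD_hom_eq_mult R hD hX hproj hXD
  have hle : classGrpD D C ≤ m.ker := by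
    rw [← ht, AddSubgroup.closure_le]
    exact fun x hx => hN x hx X hX hXN m hm
  have h0 : m (toKD D X) = 0 :=
    hle (AddSubgroup.mem_map_of_mem _ (AddSubgroup.subset_closure ⟨X, M, hM, hXM, rfl⟩))
  rw [hm, Nat.cast_eq_zero, mult_eq_zero_iff] at h0
  exact h0 (.refl X)

section Main

variable {A : Type u} [Ring A]

theorem annClass_of_isSummand {I : Submodule Aᵐᵒᵖ A} {M N : FGMod Aᵐᵒᵖ} (h : IsSummand N M)
    (hM : M ∈ annClass I) : N ∈ annClass I := by
  obtain ⟨N', ⟨e⟩⟩ := h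
  intro m a ha
  have := congrArg (fun x => (e x).1) (hM (e.symm (m, 0)) a ha)
  simpa using this

/-- If `JI = 0`, every module has a submodule annihilated by `I` (namely `MJ`) with quotient
annihilated by `J`. -/
theorem exists_submodule_annClass [IsNoetherianRing Aᵐᵒᵖ] {I J : Submodule Aᵐᵒᵖ A}
    (hI : ∀ a : A, ∀ x ∈ I, a * x ∈ I) (hJI : ∀ x ∈ J, ∀ y ∈ I, x * y = 0) (M : FGMod Aᵐᵒᵖ) :
    ∃ N : Submodule Aᵐᵒᵖ M.carrier,
      (⟨N⟩ : FGMod Aᵐᵒᵖ) ∈ annClass I ∧ (⟨M.carrier ⧸ N⟩ : FGMod Aᵐᵒᵖ) ∈ annClass J := by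
  refine ⟨Submodule.span Aᵐᵒᵖ {x | ∃ m : M.carrier, ∃ a ∈ J, x = MulOpposite.op a • m}, ?_, ?_⟩
  · rintro ⟨x, hx⟩ b hb
    refine Subtype.ext (?_ : MulOpposite.op b • x = 0)
    induction hx using Submodule.span_induction generalizing b with
    | mem x hx =>
      obtain ⟨m, a, ha, rfl⟩ := hx
      rw [← mul_smul, ← MulOpposite.op_mul, hJI a ha b hb, MulOpposite.op_zero, zero_smul]
    | zero => exact smul_zero _
    | add x y _ _ hx hy => rw [smul_add, hx b hb, hy b hb, add_zero]
    | smul s x _ hx =>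
      rw [← mul_smul, ← MulOpposite.op_unop s, ← MulOpposite.op_mul]
      exact hx _ (hI _ b hb)
  · intro x a ha
    obtain ⟨m, rfl⟩ := Submodule.Quotient.mk_surjective _ x
    exact (Submodule.Quotient.mk_eq_zero _).mpr (Submodule.subset_span ⟨m, a, ha, rfl⟩)

/-- The modules `V₀ ⊕ D₀` with `V₀ ∈ add V` and `D₀ ∈ D`. -/
def sumClass {S : Type u} [Ring S] (V : FGMod S) (D : Set (FGMod S)) : Set (FGMod S) :=
  {M | ∃ V₀ ∈ addOf {V}, ∃ D₀ ∈ D, Nonempty (M.carrier ≃ₗ[S] V₀.carrier × D₀.carrier)}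

section SumClass

variable {S : Type u} [Ring S] {V : FGMod S} {D : Set (FGMod S)}

theorem sumClass_of_equiv_prod (hD : D = addOf D) {M N N' : FGMod S}
    (e : M.carrier ≃ₗ[S] N.carrier × N'.carrier) (hN : N ∈ sumClass V D)
    (hN' : N' ∈ sumClass V D) : M ∈ sumClass V D := by
  obtain ⟨V₀, hV₀, D₀, hD₀, ⟨e₀⟩⟩ := hN
  obtain ⟨V₁, hV₁, D₁, hD₁, ⟨e₁⟩⟩ := hN'
  refine ⟨prodMod V₀ V₁, addOf_prodMod hV₀ hV₁, prodMod D₀ D₁, ?_,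
    ⟨e.trans ((e₀.prodCongr e₁).trans (LinearEquiv.prodProdProdComm S _ _ _ _))⟩⟩
  rw [hD] at hD₀ hD₁ ⊢
  exact addOf_prodMod hD₀ hD₁

theorem sumClass_of_mem_addOf (hD : D = addOf D) {M : FGMod S} (hM : M ∈ addOf {V}) :
    M ∈ sumClass V D :=
  ⟨M, hM, ⟨PUnit⟩, hD ▸ addOf_of_subsingleton D (inferInstanceAs (Subsingleton PUnit)),
    ⟨LinearEquiv.prodUnique.symm⟩⟩

theorem sumClass_of_mem {M : FGMod S} (hM : M ∈ D) : M ∈ sumClass V D :=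
  ⟨⟨PUnit⟩, addOf_of_subsingleton _ (inferInstanceAs (Subsingleton PUnit)), M, hM,
    ⟨LinearEquiv.uniqueProd.symm⟩⟩

theorem sumClass_of_forall_indec [IsArtinianRing S] (hD : D = addOf D) {p : FGMod S → Prop}
    (hp : ∀ M N, IsSummand N M → p M → p N)
    (h : ∀ M, p M → Indec M → M ∉ D → M ∈ addOf {V}) (M : FGMod S) (hM : p M) :
    M ∈ sumClass V D := by
  refine indec_induction hp (fun M h0 => sumClass_of_mem_addOf hD (addOf_of_subsingleton _ h0))
    (fun M hM hi => ?_) (fun M N N' e hN hN' => sumClass_of_equiv_prod hD e hN hN') M hM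
  by_cases hMD : M ∈ D
  · exact sumClass_of_mem hMD
  · exact sumClass_of_mem_addOf hD (h M hM hi hMD)

end SumClass

/-- If `JI = 0`, the modules over `A/I` and the syzygies of the modules over `A/J` control the
whole module category. -/
theorem isLITClass_of_sumClass [IsNoetherianRing Aᵐᵒᵖ] {I J : Submodule Aᵐᵒᵖ A}
    (hI : ∀ a : A, ∀ x ∈ I, a * x ∈ I) (hJI : ∀ x ∈ J, ∀ y ∈ I, x * y = 0)
    {V : FGMod Aᵐᵒᵖ} {D : Set (FGMod Aᵐᵒᵖ)} (hD : D = addOf D)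
    (hV : IsSummand (FGMod.regular Aᵐᵒᵖ) V) (h₁ : ∀ M ∈ annClass I, M ∈ sumClass V D)
    (h₂ : ∀ M ∈ annClass J, ∃ K P : FGMod Aᵐᵒᵖ, P.IsProj ∧ SES K P M ∧ K ∈ sumClass V D) :
    IsLITClass 0 V D Set.univ := by
  intro M _
  obtain ⟨N, hN, hMN⟩ := exists_submodule_annClass hI hJI M
  obtain ⟨K, P, hP, ⟨i, p, hi, hp, hip⟩, V₁, hV₁, D₁, hD₁, ⟨e₁⟩⟩ := h₂ _ hMN
  have hmid : prodMod ⟨N⟩ P ∈ sumClass V D := sumClass_of_equiv_prod hD (.refl _ _) (h₁ _ hN)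
    (sumClass_of_mem_addOf hD (addOf_singleton_mono hP.mem_addOf_regular hV))
  obtain ⟨V₀, hV₀, D₀, hD₀, ⟨e₀⟩⟩ := hmid
  refine ⟨V₁, V₀, D₁, D₀, hV₁, hV₀, hD₁, hD₀, ?_⟩
  suffices h : SES K (prodMod ⟨N⟩ P) M from h.of_equiv e₁ e₀ (.refl _ _)
  have : Module.Projective Aᵐᵒᵖ P.carrier := hP
  obtain ⟨q, hq⟩ := Module.projective_lifting_property N.mkQ p N.mkQ_surjective
  have hqp (x : P.carrier) : (Submodule.Quotient.mk (q x) : M.carrier ⧸ N) = p x :=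
    LinearMap.congr_fun hq x
  have hpi (k : K.carrier) : p (i k) = 0 :=
    LinearMap.mem_ker.mp (hip ▸ LinearMap.mem_range_self i k)
  have hqi (k : K.carrier) : (q ∘ₗ i) k ∈ N := by
    rw [← Submodule.Quotient.mk_eq_zero]
    exact (hqp (i k)).trans (hpi k)
  refine ⟨(-(q ∘ₗ i).codRestrict N hqi).prod i, N.subtype.coprod q, fun x y hxy => ?_,
    fun m => ?_, ?_⟩
  · exact hi (congrArg Prod.snd hxy)
  · obtain ⟨x, hx⟩ := hp (Submodule.Quotient.mk m)
    rw [← hqp, eq_comm, Submodule.Quotient.eq] at hx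
    exact ⟨(⟨m - q x, hx⟩, x), sub_add_cancel m (q x)⟩
  · ext ⟨n, x⟩
    constructor
    · rintro ⟨k, hk⟩
      rw [← hk]
      exact neg_add_cancel (q (i k))
    · intro h
      have h0 : (n : M.carrier) + q x = 0 := h
      have hx : x ∈ LinearMap.ker p := by
        rw [LinearMap.mem_ker, ← hqp, Submodule.Quotient.mk_eq_zero,
          ← neg_eq_of_add_eq_zero_right h0]
        exact N.neg_mem n.2
      rw [← hip] at hx
      obtain ⟨k, rfl⟩ := hx
      exact ⟨k, Prod.ext (Subtype.ext (neg_eq_of_add_eq_zero_left h0)) rfl⟩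

/-- A single module containing representatives of finitely many isomorphism classes. -/
theorem FinUpToIso.exists_isSummand {S : Type u} [Ring S] [IsNoetherianRing S]
    {C : Set (FGMod S)} (hC : FinUpToIso C) : ∃ W : FGMod S, ∀ M ∈ C, IsSummand M W := by
  obtain ⟨n, f, hf⟩ := hC
  refine ⟨dsum f, fun M hM => ?_⟩
  obtain ⟨i, ⟨e⟩⟩ := hf M hM
  exact (IsSummand.of_equiv e.symm).trans (isSummand_dsum f i)

end Main

/-!
STATEMENT 13 (Proposition).  Let `D` be a `0`-Igusa-Todorov subcategory and `I, J`
two (two-sided) ideals of `A` with `JI = 0`.  Then `A` is a `0`-LIT algebra provided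
that either
(1) `ind(A/I) \ D` and `ind(A/J) \ D` are finite (inside `mod A`); or
(2) `ind(A/I) \ D` is finite, `A/J` is projective in `mod A`, and `[Ω(mod A/J)]_D`
is finitely generated.
Ideals are encoded as right ideals (`Submodule Aᵐᵒᵖ A`) which are stable under left
multiplication.
-/
theorem stmt_13 (R A : Type u) [CommRing R] [IsArtinianRing R] [Ring A] [Algebra R A]
    [Module.Finite R A]
    (L : AddMonoid.End (K0 Aᵐᵒᵖ)) (hL : IsSyzEnd L)
    (D : Set (FGMod Aᵐᵒᵖ)) (hD : IsZeroIT L D)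
    (I J : Submodule Aᵐᵒᵖ A)
    (hI : ∀ a : A, ∀ x ∈ I, a * x ∈ I) (hJ : ∀ a : A, ∀ x ∈ J, a * x ∈ J)
    (hJI : ∀ x ∈ J, ∀ y ∈ I, x * y = 0)
    (hcase :
      (FinUpToIso {M | M ∈ annClass I ∧ M ∉ D ∧ Indec M} ∧
        FinUpToIso {M | M ∈ annClass J ∧ M ∉ D ∧ Indec M}) ∨
      (FinUpToIso {M | M ∈ annClass I ∧ M ∉ D ∧ Indec M} ∧
        (qmod J).IsProj ∧
        (classGrpD D (syz '' annClass J)).FG)) :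
    IsNLITAlgebra L 0 := by
  have : IsArtinianRing Aᵐᵒᵖ := IsArtinianRing.of_finite R Aᵐᵒᵖ
  obtain ⟨hadd, hsyz, -⟩ := id hD
  have hsum (I' : Submodule Aᵐᵒᵖ A) (M N : FGMod Aᵐᵒᵖ) (h : IsSummand N M)
      (hM : M ∈ annClass I') : N ∈ annClass I' := annClass_of_isSummand h hM
  rcases hcase with ⟨hfinI, n, f, hf⟩ | ⟨hfinI, -, hfg⟩
  · obtain ⟨W, hW⟩ := hfinI.exists_isSummand
    let U := dsum fun i => syz (f i)
    let V := prodMod (FGMod.regular Aᵐᵒᵖ) (prodMod W U)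
    refine ⟨V, D, hD, isLITClass_of_sumClass hI hJI hadd (isSummand_prodMod_left _ _)
      (sumClass_of_forall_indec hadd (hsum I) fun M hM hi hMD => ?_) fun M hM => ?_⟩
    · exact addOf_singleton_of_isSummand ((hW M ⟨hM, hMD, hi⟩).trans
        ((isSummand_prodMod_left W U).trans (isSummand_prodMod_right _ _)))
    · refine indec_induction (q := fun M => ∃ K P : FGMod Aᵐᵒᵖ, P.IsProj ∧ SES K P M ∧
        K ∈ sumClass V D) (hsum J) (fun M h0 => ?_) (fun M hM hi => ?_) ?_ M hM
      · refine ⟨M, M, ?_, ⟨.id, 0, injective_id, fun x => ⟨0, Subsingleton.elim _ _⟩, ?_⟩,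
          sumClass_of_mem_addOf hadd (addOf_of_subsingleton _ h0)⟩
        · exact inferInstanceAs (Module.Projective Aᵐᵒᵖ M.carrier)
        · exact Subsingleton.elim _ _
      · by_cases hMD : M ∈ D
        · obtain ⟨P, hP, hses⟩ := exists_SES_syz M
          exact ⟨syz M, P, hP, hses, sumClass_of_mem (hsyz M hMD)⟩
        · obtain ⟨i, ⟨e⟩⟩ := hf M ⟨hM, hMD, hi⟩
          obtain ⟨P, hP, hses⟩ := exists_SES_syz (f i)
          refine ⟨syz (f i), P, hP, hses.of_equiv (.refl _ _) (.refl _ _) e.symm,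
            sumClass_of_mem_addOf hadd (addOf_singleton_of_isSummand ?_)⟩
          exact (isSummand_dsum (fun i => syz (f i)) i).trans
            ((isSummand_prodMod_right W U).trans (isSummand_prodMod_right _ _))
      · rintro M N N' e ⟨K, P, hP, hses, hK⟩ ⟨K', P', hP', hses', hK'⟩
        exact ⟨prodMod K K', prodMod P P', hP.prodMod hP',
          (hses.prod hses').of_equiv (.refl _ _) (.refl _ _) e.symm,
          sumClass_of_equiv_prod hadd (.refl _ _) hK hK'⟩
  · obtain ⟨W, hW⟩ := hfinI.exists_isSummand
    obtain ⟨U, hU⟩ := exists_isSummand_of_classGrpD_fg R hadd hfg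
    let V := prodMod (FGMod.regular Aᵐᵒᵖ) (prodMod W U)
    refine ⟨V, D, hD, isLITClass_of_sumClass hI hJI hadd (isSummand_prodMod_left _ _)
      (sumClass_of_forall_indec hadd (hsum I) fun M hM hi hMD => ?_) fun M hM => ?_⟩
    · exact addOf_singleton_of_isSummand ((hW M ⟨hM, hMD, hi⟩).trans
        ((isSummand_prodMod_left W U).trans (isSummand_prodMod_right _ _)))
    · obtain ⟨P, hP, hses⟩ := exists_SES_syz M
      refine ⟨syz M, P, hP, hses, sumClass_of_forall_indec hadd
        (p := fun X => IsSummand X (syz M)) (fun _ _ h h' => h.trans h')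
        (fun X hX hi hXD => ?_) _ (.refl _)⟩
      by_cases hXP : X.IsProj
      · exact addOf_singleton_mono hXP.mem_addOf_regular (isSummand_prodMod_left _ _)
      · exact addOf_singleton_of_isSummand ((hU X _ hi hXP hXD ⟨M, hM, rfl⟩ hX).trans
          ((isSummand_prodMod_right W U).trans (isSummand_prodMod_right _ _)))
end LIT
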